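/- Let L be a finite-dimensional non-abelian nilpotent Lie superalgebra over a field F of characteristic ≠ 2, 3, with dim L = (k | l) and dim L² = (1 | 0). Then dim(L ⊗ L) = (k + l − 1)(k + l − 1) + 2 holds if and only if L ≅ H(1, 0) ⊕ A(k − 3 | l). -/

import Mathlib

open Module Function TensorProduct

universe u v w x y z

/-- The sign `(-1)^(ab)` for degrees `a b : ZMod 2`, as an element of the field `F`. -/
def sgn (F : Type u) [Field F] (a b : ZMod 2) : F :=
  if a = 1 ∧ b = 1 then -1 else 1

/-- A supermodule (ℤ/2-graded vector space) over `F`. -/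
class SuperModule (F : Type u) (V : Type v) [Field F] [AddCommGroup V] [Module F V] where
  grade : ZMod 2 → Submodule F V
  isCompl_grade : IsCompl (grade 0) (grade 1)

/-- The graded piece of degree `a`. -/
abbrev gr (F : Type u) (V : Type v) [Field F] [AddCommGroup V] [Module F V]
    [s : SuperModule F V] (a : ZMod 2) : Submodule F V := s.grade a

/-- A Lie superalgebra structure on a supermodule. -/
class LieSuperAlgebra (F : Type u) (L : Type v) [Field F] [AddCommGroup L] [Module F L]
    [SuperModule F L] where
  bracket : L →ₗ[F] L →ₗ[F] L
  bracket_grade : ∀ (a b : ZMod 2) (x y : L), x ∈ gr F L a → y ∈ gr F L b →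
    bracket x y ∈ gr F L (a + b)
  skew : ∀ (a b : ZMod 2) (x y : L), x ∈ gr F L a → y ∈ gr F L b →
    bracket x y = -(sgn F a b) • bracket y x
  jacobi : ∀ (a b c : ZMod 2) (x y zz : L), x ∈ gr F L a → y ∈ gr F L b → zz ∈ gr F L c →
    sgn F a c • bracket x (bracket y zz) + sgn F b a • bracket y (bracket zz x)
      + sgn F c b • bracket zz (bracket x y) = 0

/-- The bracket of a Lie superalgebra. -/
abbrev br (F : Type u) (L : Type v) [Field F] [AddCommGroup L] [Module F L] [SuperModule F L]
    [s : LieSuperAlgebra F L] : L →ₗ[F] L →ₗ[F] L := s.bracket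

/-- A graded submodule. -/
def IsGradedSub (F : Type u) {V : Type v} [Field F] [AddCommGroup V] [Module F V]
    [SuperModule F V] (N : Submodule F V) : Prop :=
  N ≤ (N ⊓ gr F V 0) ⊔ (N ⊓ gr F V 1)

section LSADefs

variable (F : Type u) [Field F]
variable (L : Type v) [AddCommGroup L] [Module F L] [SuperModule F L] [LieSuperAlgebra F L]

/-- The derived subalgebra `L² = [L, L]`. -/
def derivedSub : Submodule F L := Submodule.span F {t | ∃ x y : L, br F L x y = t}

/-- The center `Z(L)`. -/
def centerSub : Submodule F L := ⨅ x : L, LinearMap.ker ((br F L).flip x)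

/-- The span of brackets `[A, B]` of two submodules. -/
def bracketSub (A B : Submodule F L) : Submodule F L :=
  Submodule.span F {t | ∃ x ∈ A, ∃ y ∈ B, br F L x y = t}

/-- Abelian Lie superalgebra. -/
def IsAbelianLSA : Prop := ∀ x y : L, br F L x y = 0

/-- The lower central series. -/
def lcs : ℕ → Submodule F L
  | 0 => ⊤
  | n + 1 => Submodule.span F {t | ∃ x : L, ∃ y ∈ lcs n, br F L x y = t}

/-- Nilpotent Lie superalgebra. -/
def IsNilpotentLSA : Prop := ∃ n : ℕ, lcs F L n = ⊥

end LSADefs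

/-- Homomorphism of Lie superalgebras: an even linear map preserving grading and bracket. -/
structure LieSuperHom (F : Type u) (L : Type v) (M : Type w) [Field F]
    [AddCommGroup L] [Module F L] [SuperModule F L] [LieSuperAlgebra F L]
    [AddCommGroup M] [Module F M] [SuperModule F M] [LieSuperAlgebra F M]
    extends L →ₗ[F] M where
  map_grade : ∀ (a : ZMod 2) (x : L), x ∈ gr F L a → toLinearMap x ∈ gr F M a
  map_bracket : ∀ x y : L, toLinearMap (br F L x y) = br F M (toLinearMap x) (toLinearMap y)

/-- Isomorphism of Lie superalgebras. -/
def LSAIsomorphic (F : Type u) (L : Type v) (M : Type w) [Field F]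
    [AddCommGroup L] [Module F L] [SuperModule F L] [LieSuperAlgebra F L]
    [AddCommGroup M] [Module F M] [SuperModule F M] [LieSuperAlgebra F M] : Prop :=
  ∃ f : LieSuperHom F L M, Function.Bijective f.toLinearMap

/-- `Q` is (a realization of) the quotient `L / L²`, i.e. the abelianization of `L`. -/
def IsQuotientByDerived (F : Type u) (L : Type v) (Q : Type w) [Field F]
    [AddCommGroup L] [Module F L] [SuperModule F L] [LieSuperAlgebra F L]
    [AddCommGroup Q] [Module F Q] [SuperModule F Q] [LieSuperAlgebra F Q] : Prop :=
  ∃ f : LieSuperHom F L Q, Function.Surjective f.toLinearMap ∧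
    LinearMap.ker f.toLinearMap = derivedSub F L

/-- An action of the Lie superalgebra `P` on the Lie superalgebra `M`. -/
structure LieSuperAction (F : Type u) (P : Type v) (M : Type w) [Field F]
    [AddCommGroup P] [Module F P] [SuperModule F P] [LieSuperAlgebra F P]
    [AddCommGroup M] [Module F M] [SuperModule F M] [LieSuperAlgebra F M] where
  act : P →ₗ[F] M →ₗ[F] M
  act_grade : ∀ (a b : ZMod 2) (p : P) (m : M), p ∈ gr F P a → m ∈ gr F M b →
    act p m ∈ gr F M (a + b)
  act_bracket : ∀ (a b : ZMod 2) (p p' : P) (m : M), p ∈ gr F P a → p' ∈ gr F P b →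
    act (br F P p p') m = act p (act p' m) - sgn F a b • act p' (act p m)
  act_lie : ∀ (a b : ZMod 2) (p : P) (m m' : M), p ∈ gr F P a → m ∈ gr F M b →
    act p (br F M m m') = br F M (act p m) m' + sgn F a b • br F M m (act p m')

/-- A trivial action. -/
def LieSuperAction.IsTrivial {F : Type u} {P : Type v} {M : Type w} [Field F]
    [AddCommGroup P] [Module F P] [SuperModule F P] [LieSuperAlgebra F P]
    [AddCommGroup M] [Module F M] [SuperModule F M] [LieSuperAlgebra F M]
    (α : LieSuperAction F P M) : Prop := ∀ (p : P) (m : M), α.act p m = 0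

/-- The trivial action of `P` on `M`. -/
def trivialAction (F : Type u) (P : Type v) (M : Type w) [Field F]
    [AddCommGroup P] [Module F P] [SuperModule F P] [LieSuperAlgebra F P]
    [AddCommGroup M] [Module F M] [SuperModule F M] [LieSuperAlgebra F M] :
    LieSuperAction F P M where
  act := 0
  act_grade := by
    intro a b p m _ _
    simp only [LinearMap.zero_apply]
    exact (gr F M (a + b)).zero_mem
  act_bracket := by intro a b p p' m _ _; simp
  act_lie := by intro a b p m m' _ _; simp

/-- A Lie superpairing on `M × N` (relative to mutual actions) with values in the
Lie superalgebra `T`; these are exactly the defining relations of the non-abelian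
tensor product `M ⊗ N`. -/
structure SuperPairing (F : Type u) (M : Type v) (N : Type w) (T : Type x) [Field F]
    [AddCommGroup M] [Module F M] [SuperModule F M] [LieSuperAlgebra F M]
    [AddCommGroup N] [Module F N] [SuperModule F N] [LieSuperAlgebra F N]
    [AddCommGroup T] [Module F T] [SuperModule F T] [LieSuperAlgebra F T]
    (α : LieSuperAction F M N) (β : LieSuperAction F N M) where
  pair : M →ₗ[F] N →ₗ[F] T
  pair_grade : ∀ (a b : ZMod 2) (m : M) (n : N), m ∈ gr F M a → n ∈ gr F N b →
    pair m n ∈ gr F T (a + b)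
  rel1 : ∀ (a b : ZMod 2) (m m' : M) (n : N), m ∈ gr F M a → m' ∈ gr F M b →
    pair (br F M m m') n = pair m (α.act m' n) - sgn F a b • pair m' (α.act m n)
  rel2 : ∀ (a b c : ZMod 2) (m : M) (n n' : N), m ∈ gr F M a → n ∈ gr F N b → n' ∈ gr F N c →
    pair m (br F N n n') = sgn F c (a + b) • pair (β.act n' m) n - sgn F a b • pair (β.act n m) n'
  rel3 : ∀ (a b : ZMod 2) (m : M) (n : N) (m' : M) (n' : N), m ∈ gr F M a → n ∈ gr F N b →
    br F T (pair m n) (pair m' n') = - sgn F a b • pair (β.act n m) (α.act m' n')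

/-- `T`, together with the pairing `p`, is (a realization of) the non-abelian tensor
product `M ⊗ N`: it satisfies the universal property among Lie superpairings. -/
def IsTensorProductLSA (F : Type u) (M : Type v) (N : Type w) (T : Type x) [Field F]
    [AddCommGroup M] [Module F M] [SuperModule F M] [LieSuperAlgebra F M]
    [AddCommGroup N] [Module F N] [SuperModule F N] [LieSuperAlgebra F N]
    [AddCommGroup T] [Module F T] [SuperModule F T] [LieSuperAlgebra F T]
    (α : LieSuperAction F M N) (β : LieSuperAction F N M)
    (p : SuperPairing F M N T α β) : Prop :=
  ∀ (T' : Type (max u v w x)) [AddCommGroup T'] [Module F T'] [SuperModule F T']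
    [LieSuperAlgebra F T'] (q : SuperPairing F M N T' α β),
    ∃! h : LieSuperHom F T T', ∀ (m : M) (n : N), h.toLinearMap (p.pair m n) = q.pair m n

/-- A Lie superpairing for the tensor square `L ⊗ L` (with adjoint actions):
the defining relations of the non-abelian tensor square. -/
structure TensorSqPairing (F : Type u) (L : Type v) (T : Type w) [Field F]
    [AddCommGroup L] [Module F L] [SuperModule F L] [LieSuperAlgebra F L]
    [AddCommGroup T] [Module F T] [SuperModule F T] [LieSuperAlgebra F T] where
  pair : L →ₗ[F] L →ₗ[F] T
  pair_grade : ∀ (a b : ZMod 2) (x y : L), x ∈ gr F L a → y ∈ gr F L b →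
    pair x y ∈ gr F T (a + b)
  rel1 : ∀ (a b : ZMod 2) (x x' y : L), x ∈ gr F L a → x' ∈ gr F L b →
    pair (br F L x x') y = pair x (br F L x' y) - sgn F a b • pair x' (br F L x y)
  rel2 : ∀ (a b c : ZMod 2) (x y y' : L), x ∈ gr F L a → y ∈ gr F L b → y' ∈ gr F L c →
    pair x (br F L y y') = sgn F c (a + b) • pair (br F L y' x) y
      - sgn F a b • pair (br F L y x) y'
  rel3 : ∀ (a b : ZMod 2) (x y x' y' : L), x ∈ gr F L a → y ∈ gr F L b →
    br F T (pair x y) (pair x' y') = - sgn F a b • pair (br F L y x) (br F L x' y')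

/-- `T`, together with the pairing `p`, is (a realization of) the non-abelian tensor
square `L ⊗ L`. -/
def IsTensorSquare (F : Type u) (L : Type v) (T : Type w) [Field F]
    [AddCommGroup L] [Module F L] [SuperModule F L] [LieSuperAlgebra F L]
    [AddCommGroup T] [Module F T] [SuperModule F T] [LieSuperAlgebra F T]
    (p : TensorSqPairing F L T) : Prop :=
  ∀ (T' : Type (max u v w)) [AddCommGroup T'] [Module F T'] [SuperModule F T']
    [LieSuperAlgebra F T'] (q : TensorSqPairing F L T'),
    ∃! h : LieSuperHom F T T', ∀ x y : L, h.toLinearMap (p.pair x y) = q.pair x y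

/-- The submodule `L □ L` of a realization `T` of `L ⊗ L`, generated by the elements
`x ⊗ x' + (-1)^{|x||x'|} (x' ⊗ x)` (homogeneous `x, x'`) and `x₀ ⊗ x₀` (`x₀` even). -/
def squareBox (F : Type u) (L : Type v) (T : Type w) [Field F]
    [AddCommGroup L] [Module F L] [SuperModule F L] [LieSuperAlgebra F L]
    [AddCommGroup T] [Module F T] [SuperModule F T] [LieSuperAlgebra F T]
    (p : TensorSqPairing F L T) : Submodule F T :=
  Submodule.span F
    ({t | ∃ (a b : ZMod 2) (x y : L), x ∈ gr F L a ∧ y ∈ gr F L b ∧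
        t = p.pair x y + sgn F a b • p.pair y x} ∪
      {t | ∃ x ∈ gr F L 0, t = p.pair x x})

/-- Data of a "universal quadratic functor" target: maps satisfying the defining
relations of `Γ(V)`. -/
structure GammaData (F : Type u) (V : Type v) (W : Type w) [Field F]
    [AddCommGroup V] [Module F V] [SuperModule F V] [AddCommGroup W] [Module F W] where
  gam : V → W
  bil : V →ₗ[F] V →ₗ[F] W
  gam_smul : ∀ (c : F) (v : V), v ∈ gr F V 0 → gam (c • v) = (c * c) • gam v
  gam_add : ∀ v w' : V, v ∈ gr F V 0 → w' ∈ gr F V 0 →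
    gam (v + w') - gam v - gam w' = bil v w'
  bil_symm : ∀ (a b : ZMod 2) (v w' : V), v ∈ gr F V a → w' ∈ gr F V b →
    bil v w' = sgn F a b • bil w' v
  bil_alt : ∀ v : V, v ∈ gr F V 1 → bil v v = 0

/-- `W`, with data `d`, is (a realization of) the universal quadratic functor `Γ(V)`. -/
def IsGamma (F : Type u) (V : Type v) (W : Type w) [Field F]
    [AddCommGroup V] [Module F V] [SuperModule F V] [AddCommGroup W] [Module F W]
    (d : GammaData F V W) : Prop :=
  ∀ (W' : Type (max u v w)) [AddCommGroup W'] [Module F W'] (d' : GammaData F V W'),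
    ∃! h : W →ₗ[F] W',
      (∀ v ∈ gr F V 0, h (d.gam v) = d'.gam v) ∧ (∀ v w' : V, h (d.bil v w') = d'.bil v w')

/-- `Fr` is a free Lie superalgebra on the graded set `(X, deg)` with inclusion `ι`. -/
def IsFreeLSA (F : Type u) (X : Type v) (deg : X → ZMod 2) (Fr : Type w) [Field F]
    [AddCommGroup Fr] [Module F Fr] [SuperModule F Fr] [LieSuperAlgebra F Fr]
    (ι : X → Fr) : Prop :=
  (∀ x : X, ι x ∈ gr F Fr (deg x)) ∧
  ∀ (K : Type (max u v w)) [AddCommGroup K] [Module F K] [SuperModule F K]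
    [LieSuperAlgebra F K] (f : X → K), (∀ x : X, f x ∈ gr F K (deg x)) →
    ∃! h : LieSuperHom F Fr K, ∀ x : X, h.toLinearMap (ι x) = f x

/-- Dimension of the degree-`a` part of the Schur multiplier `(R ∩ [Fr,Fr])/[Fr,R]`
attached to a free presentation with kernel `R`. -/
noncomputable def schurDim (F : Type u) (Fr : Type v) [Field F] [AddCommGroup Fr]
    [Module F Fr] [SuperModule F Fr] [LieSuperAlgebra F Fr]
    (R : Submodule F Fr) (a : ZMod 2) : ℕ :=
  finrank F ((R ⊓ derivedSub F Fr ⊓ gr F Fr a).map (bracketSub F Fr ⊤ R).mkQ)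

/-- `L` is (isomorphic to) the Heisenberg Lie superalgebra `H(m, n)` with even center:
it admits a homogeneous basis `x₁,…,x_{2m}, y₁,…,y_n, z` with the defining brackets. -/
def IsHmn (F : Type u) (m n : ℕ) (L : Type v) [Field F]
    [AddCommGroup L] [Module F L] [SuperModule F L] [LieSuperAlgebra F L] : Prop :=
  ∃ (xv : Fin (2 * m) → L) (yv : Fin n → L) (zv : L)
    (B : Basis ((Fin (2 * m)) ⊕ (Fin n) ⊕ Unit) F L),
    (∀ i, B (Sum.inl i) = xv i) ∧ (∀ j, B (Sum.inr (Sum.inl j)) = yv j) ∧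
    B (Sum.inr (Sum.inr ())) = zv ∧
    (∀ i, xv i ∈ gr F L 0) ∧ (∀ j, yv j ∈ gr F L 1) ∧ zv ∈ gr F L 0 ∧
    (∀ i j : Fin (2 * m), br F L (xv i) (xv j) =
      if (j : ℕ) = (i : ℕ) + m then zv else if (i : ℕ) = (j : ℕ) + m then -zv else 0) ∧
    (∀ (i : Fin (2 * m)) (j : Fin n), br F L (xv i) (yv j) = 0) ∧
    (∀ (j : Fin n) (i : Fin (2 * m)), br F L (yv j) (xv i) = 0) ∧
    (∀ j k : Fin n, br F L (yv j) (yv k) = if j = k then zv else 0) ∧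
    (∀ i, br F L (xv i) zv = 0) ∧ (∀ i, br F L zv (xv i) = 0) ∧
    (∀ j, br F L (yv j) zv = 0) ∧ (∀ j, br F L zv (yv j) = 0) ∧
    br F L zv zv = 0

/-- `L` is (isomorphic to) the Heisenberg Lie superalgebra `H_m` with odd center. -/
def IsHmOdd (F : Type u) (m : ℕ) (L : Type v) [Field F]
    [AddCommGroup L] [Module F L] [SuperModule F L] [LieSuperAlgebra F L] : Prop :=
  ∃ (xv yv : Fin m → L) (zv : L) (B : Basis ((Fin m) ⊕ (Fin m) ⊕ Unit) F L),
    (∀ i, B (Sum.inl i) = xv i) ∧ (∀ j, B (Sum.inr (Sum.inl j)) = yv j) ∧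
    B (Sum.inr (Sum.inr ())) = zv ∧
    (∀ i, xv i ∈ gr F L 0) ∧ (∀ j, yv j ∈ gr F L 1) ∧ zv ∈ gr F L 1 ∧
    (∀ i j, br F L (xv i) (xv j) = 0) ∧
    (∀ i j, br F L (xv i) (yv j) = if i = j then zv else 0) ∧
    (∀ i j, br F L (yv i) (xv j) = if i = j then -zv else 0) ∧
    (∀ i j, br F L (yv i) (yv j) = 0) ∧
    (∀ i, br F L (xv i) zv = 0) ∧ (∀ i, br F L zv (xv i) = 0) ∧
    (∀ j, br F L (yv j) zv = 0) ∧ (∀ j, br F L zv (yv j) = 0) ∧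
    br F L zv zv = 0

/-- `A` is (isomorphic to) the abelian Lie superalgebra `A(a | b)`. -/
def IsAbelianOfDim (F : Type u) (a b : ℕ) (A : Type v) [Field F]
    [AddCommGroup A] [Module F A] [SuperModule F A] [LieSuperAlgebra F A] : Prop :=
  IsAbelianLSA F A ∧ finrank F (gr F A 0) = a ∧ finrank F (gr F A 1) = b

/-- Heisenberg Lie superalgebra with even center: `Z(L) = L²` is one-dimensional,
spanned by a nonzero even element. -/
def IsHeisenbergEven (F : Type u) (L : Type v) [Field F]
    [AddCommGroup L] [Module F L] [SuperModule F L] [LieSuperAlgebra F L] : Prop :=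
  centerSub F L = derivedSub F L ∧
  ∃ zc : L, zc ≠ 0 ∧ zc ∈ gr F L 0 ∧ centerSub F L = Submodule.span F {zc}

/-- Heisenberg Lie superalgebra with odd center. -/
def IsHeisenbergOdd (F : Type u) (L : Type v) [Field F]
    [AddCommGroup L] [Module F L] [SuperModule F L] [LieSuperAlgebra F L] : Prop :=
  centerSub F L = derivedSub F L ∧
  ∃ zc : L, zc ≠ 0 ∧ zc ∈ gr F L 1 ∧ centerSub F L = Submodule.span F {zc}

/-- `P ≅ L ⊕ M` as Lie superalgebras (internal direct sum of two commuting copies). -/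
def IsDirectSumOf (F : Type u) (P : Type v) (L : Type w) (M : Type x) [Field F]
    [AddCommGroup P] [Module F P] [SuperModule F P] [LieSuperAlgebra F P]
    [AddCommGroup L] [Module F L] [SuperModule F L] [LieSuperAlgebra F L]
    [AddCommGroup M] [Module F M] [SuperModule F M] [LieSuperAlgebra F M] : Prop :=
  ∃ (f : LieSuperHom F L P) (g : LieSuperHom F M P),
    Function.Bijective (fun q : L × M => f.toLinearMap q.1 + g.toLinearMap q.2) ∧
    (∀ (x : L) (y : M), br F P (f.toLinearMap x) (g.toLinearMap y) = 0) ∧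
    (∀ (y : M) (x : L), br F P (g.toLinearMap y) (f.toLinearMap x) = 0)

/-- `S ≅ A ⊕ B ⊕ C ⊕ D` as Lie superalgebras. -/
def IsDirectSumOf4 (F : Type u) (S : Type v) (A : Type w) (B : Type x) (C : Type y)
    (D : Type z) [Field F]
    [AddCommGroup S] [Module F S] [SuperModule F S] [LieSuperAlgebra F S]
    [AddCommGroup A] [Module F A] [SuperModule F A] [LieSuperAlgebra F A]
    [AddCommGroup B] [Module F B] [SuperModule F B] [LieSuperAlgebra F B]
    [AddCommGroup C] [Module F C] [SuperModule F C] [LieSuperAlgebra F C]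
    [AddCommGroup D] [Module F D] [SuperModule F D] [LieSuperAlgebra F D] : Prop :=
  ∃ (f : LieSuperHom F A S) (g : LieSuperHom F B S) (h : LieSuperHom F C S)
    (k : LieSuperHom F D S),
    Function.Bijective (fun q : A × B × C × D =>
      f.toLinearMap q.1 + g.toLinearMap q.2.1 + h.toLinearMap q.2.2.1
        + k.toLinearMap q.2.2.2) ∧
    (∀ u v', br F S (f.toLinearMap u) (g.toLinearMap v') = 0) ∧
    (∀ u v', br F S (f.toLinearMap u) (h.toLinearMap v') = 0) ∧
    (∀ u v', br F S (f.toLinearMap u) (k.toLinearMap v') = 0) ∧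
    (∀ u v', br F S (g.toLinearMap u) (h.toLinearMap v') = 0) ∧
    (∀ u v', br F S (g.toLinearMap u) (k.toLinearMap v') = 0) ∧
    (∀ u v', br F S (h.toLinearMap u) (k.toLinearMap v') = 0)

/-- `L ≅ H(m, n) ⊕ A(a | b)`: an internal decomposition into a Heisenberg part with
even center, spanned by homogeneous elements with the defining brackets, and a central
abelian graded complement of dimension `(a | b)`. -/
def DecompHeisenbergAbelian (F : Type u) (L : Type v) [Field F]
    [AddCommGroup L] [Module F L] [SuperModule F L] [LieSuperAlgebra F L]
    (m n a b : ℕ) : Prop :=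
  ∃ (xv : Fin (2 * m) → L) (yv : Fin n → L) (zv : L) (A : Submodule F L),
    (∀ i, xv i ∈ gr F L 0) ∧ (∀ j, yv j ∈ gr F L 1) ∧ zv ∈ gr F L 0 ∧
    IsGradedSub F A ∧
    finrank F (A ⊓ gr F L 0 : Submodule F L) = a ∧
    finrank F (A ⊓ gr F L 1 : Submodule F L) = b ∧
    (∀ u ∈ A, ∀ v : L, br F L u v = 0 ∧ br F L v u = 0) ∧
    LinearIndependent F (Sum.elim xv (Sum.elim yv (fun _ : Unit => zv))) ∧
    Disjoint (Submodule.span F (Set.range (Sum.elim xv (Sum.elim yv (fun _ : Unit => zv))))) A ∧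
    Submodule.span F (Set.range (Sum.elim xv (Sum.elim yv (fun _ : Unit => zv)))) ⊔ A = ⊤ ∧
    (∀ i j : Fin (2 * m), br F L (xv i) (xv j) =
      if (j : ℕ) = (i : ℕ) + m then zv else if (i : ℕ) = (j : ℕ) + m then -zv else 0) ∧
    (∀ (i : Fin (2 * m)) (j : Fin n), br F L (xv i) (yv j) = 0) ∧
    (∀ (j : Fin n) (i : Fin (2 * m)), br F L (yv j) (xv i) = 0) ∧
    (∀ j k : Fin n, br F L (yv j) (yv k) = if j = k then zv else 0) ∧
    (∀ i, br F L (xv i) zv = 0) ∧ (∀ i, br F L zv (xv i) = 0) ∧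
    (∀ j, br F L (yv j) zv = 0) ∧ (∀ j, br F L zv (yv j) = 0) ∧
    br F L zv zv = 0

/-- The submodule of a realization of `I ⊗ J` (for graded ideals `I, J` of `M`)
generated by `x ⊗ y + (-1)^(|x||y|) y ⊗ x` and `x₀ ⊗ x₀` for `x, y, x₀ ∈ I ∩ J`,
`x₀` even. -/
def pairBox (F : Type u) (I : Type v) (J : Type w) (TIJ : Type x) (M : Type y) [Field F]
    [AddCommGroup I] [Module F I] [SuperModule F I] [LieSuperAlgebra F I]
    [AddCommGroup J] [Module F J] [SuperModule F J] [LieSuperAlgebra F J]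
    [AddCommGroup TIJ] [Module F TIJ] [SuperModule F TIJ] [LieSuperAlgebra F TIJ]
    [AddCommGroup M] [Module F M] [SuperModule F M] [LieSuperAlgebra F M]
    (ι : LieSuperHom F I M) (κ : LieSuperHom F J M)
    (α : LieSuperAction F I J) (β : LieSuperAction F J I)
    (p : SuperPairing F I J TIJ α β) : Submodule F TIJ :=
  Submodule.span F
    ({t | ∃ (a b : ZMod 2) (i i' : I) (j j' : J),
        ι.toLinearMap i = κ.toLinearMap j ∧ ι.toLinearMap i' = κ.toLinearMap j' ∧
        ι.toLinearMap i ∈ gr F M a ∧ ι.toLinearMap i' ∈ gr F M b ∧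
        t = p.pair i j' + sgn F a b • p.pair i' j} ∪
      {t | ∃ (i : I) (j : J), ι.toLinearMap i = κ.toLinearMap j ∧
        ι.toLinearMap i ∈ gr F M 0 ∧ t = p.pair i j})

section helpers

variable {F : Type u} [Field F]
variable {L : Type v} [AddCommGroup L] [Module F L] [SuperModule F L]

lemma sgn00 : sgn F 0 0 = 1 := by simp [sgn]
lemma sgn01 : sgn F 0 1 = 1 := by simp [sgn]
lemma sgn10 : sgn F 1 0 = 1 := by simp [sgn]
lemma sgn11 : sgn F 1 1 = -1 := by simp [sgn]

lemma hom_decomp (F : Type u) [Field F]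
    {L : Type v} [AddCommGroup L] [Module F L] [SuperModule F L] (x : L) :
    ∃ x0 ∈ gr F L 0, ∃ x1 ∈ gr F L 1, x0 + x1 = x := by
  have h : x ∈ gr F L 0 ⊔ gr F L 1 := by
    rw [(SuperModule.isCompl_grade (F := F) (V := L)).sup_eq_top]; trivial
  exact Submodule.mem_sup.1 h

lemma zmod2_cases (a : ZMod 2) : a = 0 ∨ a = 1 := by
  revert a; decide

variable [LieSuperAlgebra F L]

/-- sub superalgebra grading -/
@[reducible]
def subSuper (w' : Type z) (S : Submodule F L) (hS : IsGradedSub F S) :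
    SuperModule F (ULift.{z} S) where
  grade a := ((gr F L a).comap S.subtype).comap
    (ULift.moduleEquiv : ULift.{z} S ≃ₗ[F] S).toLinearMap
  isCompl_grade := by
    constructor
    · rw [Submodule.disjoint_def]
      intro x h0 h1
      have := (Submodule.disjoint_def.1
        (SuperModule.isCompl_grade (F := F) (V := L)).disjoint) _ h0 h1
      apply ULift.ext
      exact Subtype.ext this
    · rw [codisjoint_iff, Submodule.eq_top_iff']
      intro x
      obtain ⟨y, hy, t, ht, hyt⟩ := Submodule.mem_sup.1 (hS x.down.2)
      refine Submodule.mem_sup.2 ⟨ULift.up ⟨y, hy.1⟩, hy.2, ULift.up ⟨t, ht.1⟩, ht.2, ?_⟩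
      apply ULift.ext
      exact Subtype.ext hyt

@[reducible]
def subLie (w' : Type z) (S : Submodule F L) (hS : IsGradedSub F S)
    (hb : ∀ x ∈ S, ∀ y ∈ S, br F L x y ∈ S) :
    @LieSuperAlgebra F (ULift.{z} S) _ _ _ (subSuper w' S hS) :=
  letI := subSuper w' S hS
  { bracket := LinearMap.mk₂ F (fun x y => ULift.up ⟨br F L x.down y.down, hb _ x.down.2 _ y.down.2⟩)
      (by intros; apply ULift.ext; apply Subtype.ext; simp)
      (by intros; apply ULift.ext; apply Subtype.ext; simp)
      (by intros; apply ULift.ext; apply Subtype.ext; simp)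
      (by intros; apply ULift.ext; apply Subtype.ext; simp)
    bracket_grade := fun a b x y hx hy =>
      LieSuperAlgebra.bracket_grade (F := F) (L := L) a b x.down y.down hx hy
    skew := by
      intro a b x y hx hy
      apply ULift.ext; apply Subtype.ext
      exact LieSuperAlgebra.skew (F := F) (L := L) a b x.down y.down hx hy
    jacobi := by
      intro a b c x y t hx hy ht
      apply ULift.ext; apply Subtype.ext
      exact LieSuperAlgebra.jacobi (F := F) (L := L) a b c x.down y.down t.down hx hy ht }

variable {T : Type w} [AddCommGroup T] [Module F T] [SuperModule F T] [LieSuperAlgebra F T]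

def pairSpan (p : TensorSqPairing F L T) : Submodule F T :=
  Submodule.span F {t | ∃ x y, p.pair x y = t}

lemma pair_mem (p : TensorSqPairing F L T) (x y : L) : p.pair x y ∈ pairSpan p :=
  Submodule.subset_span ⟨x, y, rfl⟩

lemma pairSpan_graded (p : TensorSqPairing F L T) : IsGradedSub F (pairSpan p) := by
  refine Submodule.span_le.2 ?_
  rintro _ ⟨x, y, rfl⟩
  obtain ⟨x0, hx0, x1, hx1, rfl⟩ := hom_decomp F x
  obtain ⟨y0, hy0, y1, hy1, rfl⟩ := hom_decomp F y
  have h00 := p.pair_grade _ _ _ _ hx0 hy0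
  have h01 := p.pair_grade _ _ _ _ hx0 hy1
  have h10 := p.pair_grade _ _ _ _ hx1 hy0
  have h11 := p.pair_grade _ _ _ _ hx1 hy1
  rw [show (1 : ZMod 2) + 1 = 0 by decide] at h11
  simp only [zero_add, add_zero] at h00 h01 h10
  refine Submodule.mem_sup.2 ⟨p.pair x0 y0 + p.pair x1 y1, ?_, p.pair x0 y1 + p.pair x1 y0, ?_, ?_⟩
  · exact ⟨add_mem (pair_mem _ _ _) (pair_mem _ _ _), add_mem h00 h11⟩
  · exact ⟨add_mem (pair_mem _ _ _) (pair_mem _ _ _), add_mem h01 h10⟩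
  · simp only [map_add, LinearMap.add_apply]; abel

lemma pairSpan_br (p : TensorSqPairing F L T) :
    ∀ x ∈ pairSpan p, ∀ y ∈ pairSpan p, br F T x y ∈ pairSpan p := by
  intro x hx y hy
  have key : ∀ (a b : ZMod 2) (u v u' v' : L), u ∈ gr F L a → v ∈ gr F L b →
      br F T (p.pair u v) (p.pair u' v') ∈ pairSpan p := by
    intro a b u v u' v' hu hv
    rw [p.rel3 a b u v u' v' hu hv]
    exact Submodule.smul_mem _ _ (pair_mem _ _ _)
  refine Submodule.span_induction ?_ ?_ ?_ ?_ hx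
  · rintro _ ⟨u, v, rfl⟩
    refine Submodule.span_induction ?_ ?_ ?_ ?_ hy
    · rintro _ ⟨u', v', rfl⟩
      obtain ⟨x0, hx0, x1, hx1, rfl⟩ := hom_decomp F u
      obtain ⟨y0, hy0, y1, hy1, rfl⟩ := hom_decomp F v
      simp only [map_add, LinearMap.add_apply]
      repeat' apply add_mem
      · exact key _ _ _ _ _ _ hx0 hy0
      · exact key _ _ _ _ _ _ hx1 hy0
      · exact key _ _ _ _ _ _ hx0 hy1
      · exact key _ _ _ _ _ _ hx1 hy1
    · simp
    · intro s t _ _ hs ht; rw [map_add]; exact add_mem hs ht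
    · intro c s _ hs; rw [map_smul]; exact Submodule.smul_mem _ _ hs
  · simp
  · intro s t _ _ hs ht; rw [map_add, LinearMap.add_apply]; exact add_mem hs ht
  · intro c s _ hs; rw [map_smul, LinearMap.smul_apply]; exact Submodule.smul_mem _ _ hs

/-- inducing pairing on a subalgebra containing all pairs -/
def subPairing (w' : Type z) (p : TensorSqPairing F L T) (S : Submodule F T) (hS : IsGradedSub F S)
    (hb : ∀ x ∈ S, ∀ y ∈ S, br F T x y ∈ S) (hp : ∀ x y, p.pair x y ∈ S) :
    @TensorSqPairing F L (ULift.{z} S) _ _ _ _ _ _ _ (subSuper w' S hS) (subLie w' S hS hb) :=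
  letI := subSuper w' S hS
  letI := subLie w' S hS hb
  { pair := LinearMap.mk₂ F (fun x y => ULift.up ⟨p.pair x y, hp x y⟩)
      (by intros; apply ULift.ext; apply Subtype.ext; simp)
      (by intros; apply ULift.ext; apply Subtype.ext; simp)
      (by intros; apply ULift.ext; apply Subtype.ext; simp)
      (by intros; apply ULift.ext; apply Subtype.ext; simp)
    pair_grade := fun a b x y hx hy => p.pair_grade a b x y hx hy
    rel1 := by
      intro a b x x' y hx hx'
      apply ULift.ext; apply Subtype.ext
      exact p.rel1 a b x x' y hx hx'
    rel2 := by
      intro a b c x y y' hx hy hy'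
      apply ULift.ext; apply Subtype.ext
      exact p.rel2 a b c x y y' hx hy hy'
    rel3 := by
      intro a b x y x' y' hx hy
      apply ULift.ext; apply Subtype.ext
      exact p.rel3 a b x y x' y' hx hy }

lemma pairSpan_top (p : TensorSqPairing F L T) (hT : IsTensorSquare F L T p) :
    pairSpan p = ⊤ := by
  have gS := pairSpan_graded p
  have bS := pairSpan_br p
  have gt : IsGradedSub F (⊤ : Submodule F T) := by
    intro t _
    obtain ⟨x0, hx0, x1, hx1, rfl⟩ := hom_decomp F t
    exact Submodule.mem_sup.2 ⟨x0, ⟨trivial, hx0⟩, x1, ⟨trivial, hx1⟩, rfl⟩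
  have bt : ∀ x ∈ (⊤ : Submodule F T), ∀ y ∈ (⊤ : Submodule F T), br F T x y ∈ (⊤ : Submodule F T) :=
    fun _ _ _ _ => trivial
  let U := PUnit.{max u v w + 1}
  let i1 := subSuper.{u, w, max u v w} U _ gS
  let i2 := subLie.{u, w, max u v w} U _ gS bS
  let i3 := subSuper.{u, w, max u v w} U _ gt
  let i4 := subLie.{u, w, max u v w} U _ gt bt
  obtain ⟨h, hh, -⟩ := hT (ULift.{max u v w} (pairSpan p)) (subPairing U p _ gS bS (pair_mem p))
  obtain ⟨h', -, huniq⟩ := hT (ULift.{max u v w} (⊤ : Submodule F T))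
    (subPairing U p _ gt bt (fun _ _ => trivial))
  let up : T →ₗ[F] ULift.{max u v w} (⊤ : Submodule F T) :=
    (ULift.moduleEquiv.symm : _ ≃ₗ[F] ULift.{max u v w} (⊤ : Submodule F T)).toLinearMap ∘ₗ
      (Submodule.topEquiv.symm : T ≃ₗ[F] _).toLinearMap
  let f1 : LieSuperHom F T (ULift.{max u v w} (⊤ : Submodule F T)) :=
    { toLinearMap := up
      map_grade := fun a x hx => hx
      map_bracket := fun x y => rfl }
  let f2 : LieSuperHom F T (ULift.{max u v w} (⊤ : Submodule F T)) :=
    { toLinearMap := up ∘ₗ (pairSpan p).subtype ∘ₗ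
        (ULift.moduleEquiv : ULift.{max u v w} (pairSpan p) ≃ₗ[F] _).toLinearMap ∘ₗ h.toLinearMap
      map_grade := fun a x hx => h.map_grade a x hx
      map_bracket := fun x y => by
        have := h.map_bracket x y
        apply ULift.ext; apply Subtype.ext
        exact congrArg (fun t => (t.down : T)) this }
  have e1 := huniq f1 (fun m n => rfl)
  have e2 := huniq f2 (fun m n => by
    apply ULift.ext; apply Subtype.ext
    exact congrArg (fun t => (t.down : T)) (hh m n))
  have e : f1.toLinearMap = f2.toLinearMap := by rw [e1, e2]
  rw [Submodule.eq_top_iff']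
  intro t
  have : t = ((h.toLinearMap t).down : T) :=
    congrArg (fun t => (t.down : T)) (LinearMap.congr_fun e t)
  rw [this]
  exact (h.toLinearMap t).down.2

/-- upper bound -/
lemma finrank_le_of [FiniteDimensional F L] (p : TensorSqPairing F L T)
    (hT : IsTensorSquare F L T p) (zv : L) (hz : zv ≠ 0) (U : Submodule F T) [FiniteDimensional F U]
    (h1 : ∀ x, p.pair zv x ∈ U) (h2 : ∀ x, p.pair x zv ∈ U) :
    FiniteDimensional F T ∧
    finrank F T ≤ (finrank F L - 1) * (finrank F L - 1) + finrank F U := by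
  obtain ⟨C, hC⟩ := Submodule.exists_isCompl (Submodule.span F {zv})
  have hCd : finrank F C = finrank F L - 1 := by
    have := Submodule.finrank_add_eq_of_isCompl hC
    rw [finrank_span_singleton hz] at this
    omega
  let g : C ⊗[F] C →ₗ[F] T := TensorProduct.lift (p.pair.compl₁₂ C.subtype C.subtype)
  have htop : LinearMap.range g ⊔ U = ⊤ := by
    rw [eq_top_iff, ← pairSpan_top p hT]
    refine Submodule.span_le.2 ?_
    rintro _ ⟨x, y, rfl⟩
    have dec : ∀ x : L, ∃ c : F, ∃ u : C, c • zv + u = x := by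
      intro x
      have : x ∈ Submodule.span F {zv} ⊔ C := by rw [hC.sup_eq_top]; trivial
      obtain ⟨s, hs, t, ht, rfl⟩ := Submodule.mem_sup.1 this
      obtain ⟨c, rfl⟩ := Submodule.mem_span_singleton.1 hs
      exact ⟨c, ⟨t, ht⟩, rfl⟩
    obtain ⟨c, u, rfl⟩ := dec x
    obtain ⟨d, v, rfl⟩ := dec y
    have e : p.pair (c • zv + u) (d • zv + v) = g (u ⊗ₜ v) +
        (c • p.pair zv (d • zv + v) + d • p.pair u zv) := by
      simp [g]; abel
    rw [e]
    exact Submodule.add_mem_sup ⟨_, rfl⟩ (add_mem (U.smul_mem _ (h1 _)) (U.smul_mem _ (h2 _)))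
  have hfin : FiniteDimensional F (⊤ : Submodule F T) := by
    rw [← htop]; infer_instance
  refine ⟨Module.finite_def.2 (Submodule.fg_top _ |>.1 (Module.finite_def.1 hfin)), ?_⟩
  rw [← finrank_top F T, ← htop]
  refine (Submodule.finrank_add_le_finrank_add_finrank _ _).trans ?_
  gcongr
  refine (LinearMap.finrank_range_le g).trans ?_
  rw [Module.finrank_tensorProduct, hCd]

end helpers
section forward

lemma finrank_split {F : Type u} [Field F] {L : Type v} [AddCommGroup L] [Module F L]
    [SuperModule F L] [FiniteDimensional F L] (A : Submodule F L) (hA : IsGradedSub F A) :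
    finrank F A = finrank F (A ⊓ gr F L 0 : Submodule F L)
      + finrank F (A ⊓ gr F L 1 : Submodule F L) := by
  have h := Submodule.finrank_sup_add_finrank_inf_eq (A ⊓ gr F L 0) (A ⊓ gr F L 1)
  have e1 : (A ⊓ gr F L 0) ⊔ (A ⊓ gr F L 1) = A :=
    le_antisymm (sup_le inf_le_left inf_le_left) hA
  have e2 : (A ⊓ gr F L 0) ⊓ (A ⊓ gr F L 1) = ⊥ := by
    rw [eq_bot_iff, ← (SuperModule.isCompl_grade (F := F) (V := L)).inf_eq_bot]
    exact inf_le_inf inf_le_right inf_le_right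
  rw [e1, e2, finrank_bot] at h
  omega

variable {F : Type u} [Field F]
variable {L : Type v} [AddCommGroup L] [Module F L] [SuperModule F L] [LieSuperAlgebra F L]

lemma derived_graded : IsGradedSub F (derivedSub F L) := by
  refine Submodule.span_le.2 ?_
  rintro _ ⟨x, y, rfl⟩
  have mem : ∀ x y : L, br F L x y ∈ derivedSub F L := fun x y => Submodule.subset_span ⟨x, y, rfl⟩
  obtain ⟨x0, hx0, x1, hx1, rfl⟩ := hom_decomp F x
  obtain ⟨y0, hy0, y1, hy1, rfl⟩ := hom_decomp F y
  have h00 := LieSuperAlgebra.bracket_grade (F := F) _ _ _ _ hx0 hy0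
  have h01 := LieSuperAlgebra.bracket_grade (F := F) _ _ _ _ hx0 hy1
  have h10 := LieSuperAlgebra.bracket_grade (F := F) _ _ _ _ hx1 hy0
  have h11 := LieSuperAlgebra.bracket_grade (F := F) _ _ _ _ hx1 hy1
  rw [show (1 : ZMod 2) + 1 = 0 by decide] at h11
  simp only [zero_add, add_zero] at h00 h01 h10
  refine Submodule.mem_sup.2 ⟨br F L x0 y0 + br F L x1 y1, ?_, br F L x0 y1 + br F L x1 y0, ?_, ?_⟩
  · exact ⟨add_mem (mem _ _) (mem _ _), add_mem h00 h11⟩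
  · exact ⟨add_mem (mem _ _) (mem _ _), add_mem h01 h10⟩
  · simp only [map_add, LinearMap.add_apply]; abel

lemma setup [FiniteDimensional F L] (hnil : IsNilpotentLSA F L)
    (hr : finrank F (derivedSub F L ⊓ gr F L 0 : Submodule F L) = 1)
    (hs : finrank F (derivedSub F L ⊓ gr F L 1 : Submodule F L) = 0) :
    ∃ (zv : L) (φ : L →ₗ[F] F), zv ∈ gr F L 0 ∧ φ zv = 1 ∧ (∀ x ∈ gr F L 1, φ x = 0) ∧
      (∀ x y, br F L x y = φ (br F L x y) • zv) ∧ (∀ x, br F L x zv = 0) ∧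
      (∀ x, br F L zv x = 0) := by
  obtain ⟨⟨zv, hzv⟩, hne, hall⟩ := finrank_eq_one_iff'.1 hr
  have hz0 : zv ≠ 0 := fun h => hne (Subtype.ext h)
  have hz1 : zv ∉ gr F L 1 := fun h => hz0 ((Submodule.disjoint_def.1
        (SuperModule.isCompl_grade (F := F) (V := L)).disjoint) _ hzv.2 h)
  obtain ⟨f, hf, hf1⟩ := Submodule.exists_le_ker_of_notMem hz1
  have hs' := Submodule.finrank_eq_zero.1 hs
  have hD : ∀ x y : L, ∃ c : F, c • zv = br F L x y := by
    intro x y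
    have h : br F L x y ∈ derivedSub F L := Submodule.subset_span ⟨x, y, rfl⟩
    have h2 := derived_graded h
    rw [hs', sup_bot_eq] at h2
    obtain ⟨c, hc⟩ := hall ⟨_, h2⟩
    exact ⟨c, congrArg Subtype.val hc⟩
  have hcen : ∀ x, br F L x zv = 0 := by
    intro x
    obtain ⟨c, hc⟩ := hD x zv
    by_contra hcon
    have hc0 : c ≠ 0 := by
      rintro rfl; apply hcon; rw [← hc, zero_smul]
    obtain ⟨n, hn⟩ := hnil
    have : ∀ m, zv ∈ lcs F L m := by
      intro m
      induction m with
      | zero => trivial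
      | succ m ih =>
        have : c⁻¹ • br F L x zv ∈ lcs F L (m + 1) :=
          Submodule.smul_mem _ _ (Submodule.subset_span ⟨x, zv, ih, rfl⟩)
        rwa [← hc, smul_smul, inv_mul_cancel₀ hc0, one_smul] at this
    have := this n
    rw [hn] at this
    exact hz0 this
  refine ⟨zv, (f zv)⁻¹ • f, hzv.2, ?_, ?_, ?_, hcen, ?_⟩
  · simp [hf]
  · intro x hx
    have : f x = 0 := hf1 hx
    simp [this]
  · intro x y
    obtain ⟨c, hc⟩ := hD x y
    rw [← hc]
    simp [hf]
  · intro x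
    obtain ⟨x0, hx0, x1, hx1, rfl⟩ := hom_decomp F x
    rw [map_add, LieSuperAlgebra.skew _ _ _ _ hzv.2 hx0, LieSuperAlgebra.skew _ _ _ _ hzv.2 hx1]
    rw [show LieSuperAlgebra.bracket (F := F) x0 zv = 0 from hcen x0,
      show LieSuperAlgebra.bracket (F := F) x1 zv = 0 from hcen x1]
    simp

variable {T : Type w} [AddCommGroup T] [Module F T] [SuperModule F T] [LieSuperAlgebra F T]

lemma forward [FiniteDimensional F L] (hchar2 : ringChar F ≠ 2) (hchar3 : ringChar F ≠ 3)
    (hnab : ¬ IsAbelianLSA F L) (p : TensorSqPairing F L T)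
    (zv : L) (φ : L →ₗ[F] F) (hz : zv ∈ gr F L 0) (hφz : φ zv = 1)
    (hφ1 : ∀ x ∈ gr F L 1, φ x = 0)
    (hbr : ∀ x y, br F L x y = φ (br F L x y) • zv) (hc : ∀ x, br F L x zv = 0)
    (hc' : ∀ x, br F L zv x = 0)
    (hne : ¬ ((∀ x, p.pair zv x = 0) ∧ (∀ x, p.pair x zv = 0))) :
    DecompHeisenbergAbelian F L 1 0 (finrank F (gr F L 0) - 3) (finrank F (gr F L 1)) := by
  obtain ⟨β, hβ⟩ : ∃ β : L →ₗ[F] L →ₗ[F] F, ∀ x y, β x y = φ (br F L x y) :=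
    ⟨(br F L).compr₂ φ, fun _ _ => rfl⟩
  simp only [← hβ] at hbr
  have h2 : (2 : F) ≠ 0 := Ring.two_ne_zero hchar2
  have h3 : (3 : F) ≠ 0 := by
    intro h
    have := (ringChar.spec F 3).1 (by exact_mod_cast h)
    rcases (Nat.dvd_prime Nat.prime_three).1 this with h | h
    · have := (ringChar.spec F 1).2 (by rw [h])
      simp at this
    · exact hchar3 h
  have sk00 : ∀ x ∈ gr F L 0, ∀ y ∈ gr F L 0, β x y = - β y x := by
    intro x hx y hy
    have := LieSuperAlgebra.skew (F := F) _ _ _ _ hx hy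
    rw [sgn00] at this
    rw [hβ, hβ, br, this]; simp
  have sk11 : ∀ x ∈ gr F L 1, ∀ y ∈ gr F L 1, β x y = β y x := by
    intro x hx y hy
    have := LieSuperAlgebra.skew (F := F) _ _ _ _ hx hy
    rw [sgn11] at this
    rw [hβ, hβ, br, this]; simp
  have m01 : ∀ x ∈ gr F L 0, ∀ y ∈ gr F L 1, β x y = 0 := by
    intro x hx y hy
    have := LieSuperAlgebra.bracket_grade (F := F) _ _ _ _ hx hy
    rw [hβ]; exact hφ1 _ this
  have m10 : ∀ x ∈ gr F L 1, ∀ y ∈ gr F L 0, β x y = 0 := by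
    intro x hx y hy
    have := LieSuperAlgebra.bracket_grade (F := F) _ _ _ _ hx hy
    rw [hβ]; exact hφ1 _ this
  have βz : ∀ x, β x zv = 0 := fun x => by rw [hβ, hc, map_zero]
  have βz' : ∀ x, β zv x = 0 := fun x => by rw [hβ, hc', map_zero]
  have R1 : ∀ (a b : ZMod 2) (x x' y : L), x ∈ gr F L a → x' ∈ gr F L b →
      β x x' • p.pair zv y = β x' y • p.pair x zv - sgn F a b • β x y • p.pair x' zv := by
    intro a b x x' y hx hx'
    have := p.rel1 a b x x' y hx hx'
    rw [hbr x x', hbr x' y, hbr x y] at this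
    simpa using this
  have R2 : ∀ (a b c : ZMod 2) (x y y' : L), x ∈ gr F L a → y ∈ gr F L b → y' ∈ gr F L c →
      β y y' • p.pair x zv = sgn F c (a + b) • β y' x • p.pair zv y
        - sgn F a b • β y x • p.pair zv y' := by
    intro a b c x y y' hx hy hy'
    have := p.rel2 a b c x y y' hx hy hy'
    rw [hbr y y', hbr y' x, hbr y x] at this
    simpa using this
  have hex : ∃ x y, β x y ≠ 0 := by
    by_contra hcon
    push Not at hcon
    exact hnab fun x y => by rw [hbr, hcon, zero_smul]
  -- if `b = 0` then contradiction
  have hb0 : ¬ (∀ x, p.pair zv x = 0) := by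
    intro ha
    refine hne ⟨ha, ?_⟩
    have key : ∀ (a b c : ZMod 2) (x y y' : L), x ∈ gr F L a → y ∈ gr F L b → y' ∈ gr F L c →
      β y y' • p.pair x zv = 0 := by
      intro a b c x y y' hx hy hy'
      rw [R2 a b c x y y' hx hy hy', ha, ha]; simp
    intro x
    obtain ⟨y, y', hy⟩ := hex
    have : β y y' • p.pair x zv = 0 := by
      obtain ⟨x0, hx0, x1, hx1, rfl⟩ := hom_decomp F x
      obtain ⟨y0, hy0, y1, hy1, rfl⟩ := hom_decomp F y
      obtain ⟨w0, hw0, w1, hw1, rfl⟩ := hom_decomp F y'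
      simp only [map_add, LinearMap.add_apply, smul_add, add_smul,
        key _ _ _ _ _ _ hx0 hy0 hw0, key _ _ _ _ _ _ hx0 hy0 hw1, key _ _ _ _ _ _ hx0 hy1 hw0,
        key _ _ _ _ _ _ hx0 hy1 hw1, key _ _ _ _ _ _ hx1 hy0 hw0, key _ _ _ _ _ _ hx1 hy0 hw1,
        key _ _ _ _ _ _ hx1 hy1 hw0, key _ _ _ _ _ _ hx1 hy1 hw1, add_zero]
    exact (smul_eq_zero.1 this).resolve_left hy
  by_cases hev : ∃ x ∈ gr F L 0, ∃ y ∈ gr F L 0, β x y ≠ 0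
  swap
  · exfalso
    push Not at hev
    have hod : ∃ y ∈ gr F L 1, β y y ≠ 0 := by
      by_contra hcon
      push Not at hcon
      obtain ⟨x, y, hxy⟩ := hex
      apply hxy
      obtain ⟨x0, hx0, x1, hx1, rfl⟩ := hom_decomp F x
      obtain ⟨y0, hy0, y1, hy1, rfl⟩ := hom_decomp F y
      have h11 : β x1 y1 = 0 := by
        have h := hcon _ (add_mem hx1 hy1)
        simp only [map_add, LinearMap.add_apply, hcon _ hx1, hcon _ hy1, sk11 _ hy1 _ hx1] at h
        have : 2 * β x1 y1 = 0 := by linear_combination h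
        exact (mul_eq_zero.1 this).resolve_left h2
      simp [hev _ hx0 _ hy0, m01 _ hx0 _ hy1, m10 _ hx1 _ hy0, h11]
    obtain ⟨y, hy, hyy⟩ := hod
    have r1 := R1 _ _ y y y hy hy
    have r2 := R2 _ _ _ y y y hy hy hy
    rw [show (1 : ZMod 2) + 1 = 0 by decide] at r2
    simp only [sgn11, sgn10] at r1 r2
    have hb : p.pair y zv = 0 := by
      have : (3 * β y y * β y y) • p.pair y zv = 0 := by
        linear_combination (norm := module) (-(β y y)) • r2 - (2 * β y y) • r1
      exact (smul_eq_zero.1 this).resolve_left (mul_ne_zero (mul_ne_zero h3 hyy) hyy)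
    apply hb0
    intro x
    have r := R1 _ _ y y x hy hy
    rw [hb] at r
    simp only [smul_zero, sub_zero] at r
    exact (smul_eq_zero.1 r).resolve_left hyy
  obtain ⟨x1, hx1, x2, hx2, h12⟩ : ∃ x ∈ gr F L 0, ∃ y ∈ gr F L 0, β x y = 1 := by
    obtain ⟨x, hx, y, hy, hxy⟩ := hev
    exact ⟨x, hx, (β x y)⁻¹ • y, Submodule.smul_mem _ _ hy, by simp [hxy]⟩
  have h21 : β x2 x1 = -1 := by rw [sk00 _ hx2 _ hx1, h12]
  have h11 : ∀ x ∈ gr F L 0, β x x = 0 := by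
    intro x hx
    have := sk00 x hx x hx
    have : 2 * β x x = 0 := by linear_combination this
    exact (mul_eq_zero.1 this).resolve_left h2
  have hbw : ∀ (a : ZMod 2) (x : L), x ∈ gr F L a → β x1 x = 0 → β x2 x = 0 → p.pair x zv = 0 := by
    intro a x hx e1 e2
    have r := R2 _ _ _ x x1 x2 hx hx1 hx2
    simpa [h12, e1, e2] using r
  have hww : ∀ (a b : ZMod 2) (x x' : L), x ∈ gr F L a → x' ∈ gr F L b →
      β x1 x = 0 → β x2 x = 0 → β x1 x' = 0 → β x2 x' = 0 → β x x' = 0 := by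
    intro a b x x' hx hx' e1 e2 e3 e4
    by_contra hcon
    apply hb0
    intro y
    have r := R1 _ _ x x' y hx hx'
    rw [hbw _ _ hx e1 e2, hbw _ _ hx' e3 e4] at r
    simp only [smul_zero, sub_zero] at r
    exact (smul_eq_zero.1 r).resolve_left hcon
  let A : Submodule F L := LinearMap.ker φ ⊓ LinearMap.ker (β x1) ⊓ LinearMap.ker (β x2)
  have hA : ∀ x, x ∈ A ↔ (φ x = 0 ∧ β x1 x = 0) ∧ β x2 x = 0 := by
    intro x; simp [A]
  have hL1A : gr F L 1 ≤ A := fun x hx =>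
    (hA x).2 ⟨⟨hφ1 x hx, m01 _ hx1 _ hx⟩, m01 _ hx2 _ hx⟩
  have hAg : IsGradedSub F A := by
    intro x hx
    obtain ⟨u0, hu0, u1, hu1, rfl⟩ := hom_decomp F x
    refine Submodule.add_mem_sup ⟨?_, hu0⟩ ⟨hL1A hu1, hu1⟩
    simpa using A.sub_mem hx (hL1A hu1)
  have hAcen : ∀ u ∈ A, ∀ v : L, β u v = 0 ∧ β v u = 0 := by
    intro u hu v
    obtain ⟨u0, hu0, u1, hu1, rfl⟩ := hom_decomp F u
    obtain ⟨v0, hv0, v1, hv1, rfl⟩ := hom_decomp F v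
    have hu0A : u0 ∈ A := by simpa using A.sub_mem hu (hL1A hu1)
    obtain ⟨⟨-, a1⟩, a2⟩ := (hA _).1 hu0A
    obtain ⟨⟨-, b1⟩, b2⟩ := (hA _).1 (hL1A hu1)
    obtain ⟨⟨-, c1⟩, c2⟩ := (hA _).1 (hL1A hv1)
    have e0 : β u0 v0 = 0 := by
      have := hww _ _ u0 (v0 - (β x1 v0) • x2 + (β x2 v0) • x1) hu0
        (add_mem (sub_mem hv0 (Submodule.smul_mem _ _ hx2)) (Submodule.smul_mem _ _ hx1)) a1 a2
        (by simp [h12, h11 _ hx1]) (by simp [h21, h11 _ hx2])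
      simpa [sk00 _ hu0 _ hx1, sk00 _ hu0 _ hx2, a1, a2] using this
    have e1 : β u1 v1 = 0 := hww _ _ _ _ hu1 hv1 b1 b2 c1 c2
    have e0' : β v0 u0 = 0 := by rw [sk00 _ hv0 _ hu0, e0, neg_zero]
    have e1' : β v1 u1 = 0 := by rw [sk11 _ hv1 _ hu1, e1]
    constructor
    · simp [e0, e1, m01 _ hu0 _ hv1, m10 _ hu1 _ hv0]
    · simp [e0', e1', m01 _ hv0 _ hu1, m10 _ hv1 _ hu0]
  let xv : Fin (2 * 1) → L := ![x1, x2]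
  let yv : Fin 0 → L := fun i => i.elim0
  let fam : (Fin (2 * 1)) ⊕ (Fin 0 ⊕ Unit) → L := Sum.elim xv (Sum.elim yv (fun _ : Unit => zv))
  have hli : LinearIndependent F fam := by
    rw [Fintype.linearIndependent_iff]
    intro g hg
    simp [fam, xv, Fin.sum_univ_succ] at hg
    have e1 := congrArg (β x1) hg
    have e2 := congrArg (β x2) hg
    have e3 := congrArg φ hg
    simp [h12, h21, h11 _ hx1, h11 _ hx2, βz] at e1 e2
    simp [e1, e2, hφz] at e3
    rintro (i | i | i)
    · fin_cases i
      · exact e2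
      · exact e1
    · exact i.elim0
    · exact e3
  have hspan : Submodule.span F (Set.range fam) = Submodule.span F {x1, x2, zv} := by
    congr 1
    ext t
    simp [fam, xv, eq_comm]
    tauto
  have hdisj : Disjoint (Submodule.span F (Set.range fam)) A := by
    rw [hspan, Submodule.disjoint_def]
    intro t ht htA
    obtain ⟨c1, c2, c3, rfl⟩ := Submodule.mem_span_triple.1 ht
    obtain ⟨⟨a0, a1⟩, a2⟩ := (hA _).1 htA
    simp [h12, h21, h11 _ hx1, h11 _ hx2, βz] at a1 a2
    simp [a1, a2, hφz] at a0
    simp [a0, a1, a2]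
  have hsup : Submodule.span F (Set.range fam) ⊔ A = ⊤ := by
    rw [hspan, Submodule.eq_top_iff']
    intro t
    set s : L := (-(β x2 t)) • x1 + (β x1 t) • x2 + (φ t + β x2 t * φ x1 - β x1 t * φ x2) • zv with hs
    have : t = s + (t - s) := by abel
    rw [this]
    refine Submodule.add_mem_sup (Submodule.mem_span_triple.2 ⟨_, _, _, rfl⟩) ((hA _).2 ⟨⟨?_, ?_⟩, ?_⟩)
    · simp [hs, hφz]
    · simp [hs, h12, h11 _ hx1, βz]
    · simp [hs, h21, h11 _ hx2, βz]
  have hAL1 : A ⊓ gr F L 1 = gr F L 1 := inf_eq_right.2 hL1A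
  have hdim : finrank F (A ⊓ gr F L 0 : Submodule F L) = finrank F (gr F L 0) - 3 := by
    have d1 := Submodule.finrank_add_eq_of_isCompl (IsCompl.mk hdisj (codisjoint_iff.2 hsup))
    have d2 : finrank F (gr F L 0) + finrank F (gr F L 1) = finrank F L := Submodule.finrank_add_eq_of_isCompl (SuperModule.isCompl_grade (F := F) (V := L))
    have d3 := finrank_split A hAg
    rw [hAL1] at d3
    rw [finrank_span_eq_card hli] at d1
    simp at d1
    omega
  refine ⟨xv, yv, zv, A, ?_, fun j => j.elim0, hz, hAg, hdim, by rw [hAL1], ?_, hli, hdisj, hsup,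
    ?_, fun i j => j.elim0, fun j => j.elim0, fun j => j.elim0, fun i => hc _, fun i => hc' _,
    fun j => j.elim0, fun j => j.elim0, hc _⟩
  · intro i; fin_cases i
    · exact hx1
    · exact hx2
  · intro u hu v
    rw [hbr u v, hbr v u, (hAcen u hu v).1, (hAcen u hu v).2]; simp
  · intro i j
    rw [hbr]
    fin_cases i <;> fin_cases j <;> simp [xv, h12, h21, h11 _ hx1, h11 _ hx2]

end forward
section backward

@[reducible]
def funSuper (F : Type u) [Field F] (J : Type v) (d : J → ZMod 2) : SuperModule F (J → F) where
  grade a :=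
    { carrier := {g | ∀ j, d j ≠ a → g j = 0}
      add_mem' := by intro g h hg hh j hj; simp [hg j hj, hh j hj]
      zero_mem' := by intro j hj; rfl
      smul_mem' := by intro c g hg j hj; simp [hg j hj] }
  isCompl_grade := by
    constructor
    · rw [Submodule.disjoint_def]
      intro g h0 h1
      funext j
      by_cases h : d j = 0
      · exact h1 j (by rw [h]; decide)
      · exact h0 j h
    · rw [codisjoint_iff, Submodule.eq_top_iff']
      intro g
      refine Submodule.mem_sup.2 ⟨fun j => if d j = 0 then g j else 0, ?_,
        fun j => if d j = 0 then 0 else g j, ?_, ?_⟩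
      · intro j hj; simp [hj]
      · intro j hj
        have : d j = 0 := (zmod2_cases (d j)).resolve_right hj
        simp [this]
      · funext j
        by_cases h : d j = 0 <;> simp [h]

@[reducible]
def zeroLie (F : Type u) [Field F] (V : Type v) [AddCommGroup V] [Module F V] [SuperModule F V] :
    LieSuperAlgebra F V where
  bracket := 0
  bracket_grade := by intros; simp
  skew := by intros; simp
  jacobi := by intros; simp

variable {F : Type u} [Field F]
variable {L : Type v} [AddCommGroup L] [Module F L] [SuperModule F L] [LieSuperAlgebra F L]
variable {T : Type w} [AddCommGroup T] [Module F T] [SuperModule F T] [LieSuperAlgebra F T]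

def pfun {ι : Type} (f : ι → L →ₗ[F] F) (ζ : L →ₗ[F] F) (us : Bool → ι) (x y : L) :
    (ι × ι) ⊕ Bool → F
  | Sum.inl ij => f ij.1 x * f ij.2 y
  | Sum.inr s => ζ x * f (us s) y - ζ y * f (us s) x

def dfun {ι : Type} (d : ι → ZMod 2) : (ι × ι) ⊕ Bool → ZMod 2
  | Sum.inl ij => d ij.1 + d ij.2
  | Sum.inr _ => 0

lemma lower {ι : Type} [Fintype ι] [DecidableEq ι] [Module.Finite F T] (p : TensorSqPairing F L T)
    (hT : IsTensorSquare F L T p) (f : ι → L →ₗ[F] F) (ζ : L →ₗ[F] F) (us : Bool → ι)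
    (hus : us true ≠ us false)
    (d : ι → ZMod 2) (hd : ∀ s, d (us s) = 0)
    (hf : ∀ i a x, x ∈ gr F L a → d i ≠ a → f i x = 0) (hζ : ∀ x ∈ gr F L 1, ζ x = 0)
    (zv : L) (hfz : ∀ i, f i zv = 0) (hζz : ζ zv = 1)
    (hbr : ∀ x y, br F L x y =
      (f (us true) x * f (us false) y - f (us false) x * f (us true) y) • zv)
    (e : ι → L) (hfe : ∀ i j, f i (e j) = if i = j then 1 else 0) (hζe : ∀ i, ζ (e i) = 0) :
    Fintype.card ι * Fintype.card ι + 2 ≤ finrank F T := by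
  let J := ULift.{max v w} ((ι × ι) ⊕ Bool)
  let i1 : SuperModule F (J → F) := funSuper F J (fun j => dfun d j.down)
  let i2 : LieSuperAlgebra F (J → F) := zeroLie F (J → F)
  let pr : L →ₗ[F] L →ₗ[F] (J → F) := LinearMap.mk₂ F (fun x y (j : J) => pfun f ζ us x y j.down)
    (by rintro x x' y; funext j; rcases j with ⟨j | j⟩ <;> simp [pfun] <;> ring)
    (by rintro c x y; funext j; rcases j with ⟨j | j⟩ <;> simp [pfun] <;> ring)
    (by rintro x x' y; funext j; rcases j with ⟨j | j⟩ <;> simp [pfun] <;> ring)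
    (by rintro c x y; funext j; rcases j with ⟨j | j⟩ <;> simp [pfun] <;> ring)
  have hpr : ∀ x y j, pr x y j = pfun f ζ us x y j.down := fun _ _ _ => rfl
  have hf1 : ∀ s x, x ∈ gr F L 1 → f (us s) x = 0 := by
    intro s x hx
    exact hf _ _ _ hx (by rw [hd]; decide)
  let q : TensorSqPairing F L (J → F) :=
    { pair := pr
      pair_grade := by
        rintro a b x y hx hy ⟨⟨i, j⟩ | s⟩ hj
        · rw [hpr]
          simp only [dfun] at hj
          by_cases h1 : d i = a
          · by_cases h2 : d j = b
            · exact absurd (by rw [h1, h2]) hj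
            · simp [pfun, hf j b y hy h2]
          · simp [pfun, hf i a x hx h1]
        · rw [hpr]
          simp only [dfun] at hj
          rcases zmod2_cases a with rfl | rfl <;> rcases zmod2_cases b with rfl | rfl
          · exact absurd (by decide) hj
          · simp [pfun, hf1 s y hy, hζ y hy]
          · simp [pfun, hf1 s x hx, hζ x hx]
          · exact absurd (by decide) hj
      rel1 := by
        intro a b x x' y hx hx'
        rw [hbr x x', hbr x' y, hbr x y]
        have Hx : ∀ s, a = 1 → f (us s) x = 0 := fun s h => hf1 s x (h ▸ hx)
        have Hx' : ∀ s, b = 1 → f (us s) x' = 0 := fun s h => hf1 s x' (h ▸ hx')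
        clear hx hx'
        funext j; rcases j with ⟨⟨i, j⟩ | s⟩
        · simp [hpr, pfun, hfz]
        · rcases zmod2_cases a with rfl | rfl <;> rcases zmod2_cases b with rfl | rfl <;>
            simp only [sgn00, sgn01, sgn10, sgn11] <;> cases s <;>
            simp [hpr, pfun, hfz, hζz, Hx, Hx'] <;> ring
      rel2 := by
        intro a b c x y y' hx hy hy'
        rw [hbr y y', hbr y' x, hbr y x]
        have Hx : ∀ s, a = 1 → f (us s) x = 0 := fun s h => hf1 s x (h ▸ hx)
        have Hy : ∀ s, b = 1 → f (us s) y = 0 := fun s h => hf1 s y (h ▸ hy)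
        have Hy' : ∀ s, c = 1 → f (us s) y' = 0 := fun s h => hf1 s y' (h ▸ hy')
        clear hx hy hy'
        funext j; rcases j with ⟨⟨i, j⟩ | s⟩
        · simp [hpr, pfun, hfz]
        · rcases zmod2_cases a with rfl | rfl <;> rcases zmod2_cases b with rfl | rfl <;>
            rcases zmod2_cases c with rfl | rfl <;>
            simp only [zero_add, add_zero, sgn00, sgn01, sgn10, sgn11] <;> cases s <;>
            simp [hpr, pfun, hfz, hζz, Hx, Hy, Hy'] <;> ring
      rel3 := by
        intro a b x y x' y' hx hy
        rw [hbr y x, hbr x' y']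
        change (0 : J → F) = _
        funext j; rcases j with ⟨⟨i, j⟩ | s⟩
        · simp [hpr, pfun, hfz]
        · simp [hpr, pfun, hfz] }
  obtain ⟨h, hh, -⟩ := hT (J → F) q
  have hsing : ∀ j j' : (ι × ι) ⊕ Bool,
      (Pi.basisFun F J) (ULift.up j) (ULift.up j') = if j' = j then 1 else 0 := by
    intro j j'
    rw [Pi.basisFun_apply, Pi.single_apply]
    by_cases h : j' = j
    · subst h; simp
    · rw [if_neg h, if_neg]
      intro hh
      exact h (congrArg ULift.down hh)
  have hsurj : LinearMap.range h.toLinearMap = ⊤ := by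
    rw [eq_top_iff, ← (Pi.basisFun F J).span_eq]
    refine Submodule.span_le.2 ?_
    rintro _ ⟨⟨⟨i, j⟩ | s⟩, rfl⟩
    · refine ⟨p.pair (e i) (e j), ?_⟩
      rw [hh]
      funext j0; rcases j0 with ⟨⟨i', j'⟩ | s'⟩
      · refine Eq.trans ?_ (hsing _ _).symm
        change f i' (e i) * f j' (e j) = _
        simp only [hfe, Sum.inl.injEq, Prod.mk.injEq]
        by_cases h1 : i' = i <;> by_cases h2 : j' = j <;> simp [h1, h2]
      · refine Eq.trans ?_ (hsing _ _).symm
        change ζ (e i) * f (us s') (e j) - ζ (e j) * f (us s') (e i) = _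
        simp [hζe]
    · refine ⟨p.pair zv (e (us s)), ?_⟩
      rw [hh]
      funext j0; rcases j0 with ⟨⟨i', j'⟩ | s'⟩
      · refine Eq.trans ?_ (hsing _ _).symm
        change f i' zv * f j' (e (us s)) = _
        simp [hfz]
      · refine Eq.trans ?_ (hsing _ _).symm
        change ζ zv * f (us s') (e (us s)) - ζ (e (us s)) * f (us s') zv = _
        simp only [hζz, hfz, hfe, Sum.inr.injEq]
        cases s <;> cases s' <;> simp [hus, hus.symm]
  have := LinearMap.finrank_range_le h.toLinearMap
  rw [hsurj, finrank_top, Module.finrank_fintype_fun_eq_card] at this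
  simpa [J] using this

/-- coordinates of a homogeneous basis are homogeneous -/
lemma coord_hom {ι : Type} [Fintype ι] (B : Basis ι F L) (d : ι → ZMod 2)
    (hB : ∀ i, B i ∈ gr F L (d i)) (i : ι) (a : ZMod 2) (x : L) (hx : x ∈ gr F L a)
    (hi : d i ≠ a) : B.coord i x = 0 := by
  classical
  have hmem : ∀ c, ∑ j ∈ Finset.univ.filter (fun j => d j = c), B.coord j x • B j ∈ gr F L c := by
    intro c
    refine Submodule.sum_mem _ fun j hj => Submodule.smul_mem _ _ ?_
    have := (Finset.mem_filter.1 hj).2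
    rw [← this]; exact hB j
  have hsum : ∑ j ∈ Finset.univ.filter (fun j => d j = a), B.coord j x • B j +
      ∑ j ∈ Finset.univ.filter (fun j => d j = d i), B.coord j x • B j = x := by
    conv_rhs => rw [← B.sum_repr x]
    rw [← Finset.sum_filter_add_sum_filter_not Finset.univ (fun j => d j = a)]
    congr 1
    refine Finset.sum_congr ?_ fun _ _ => rfl
    ext j
    simp only [Finset.mem_filter, Finset.mem_univ, true_and]
    have key : ∀ a m n : ZMod 2, m ≠ a → (¬ n = a ↔ n = m) := by decide
    exact (key a (d i) (d j) hi).symm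
  have h0 : ∑ j ∈ Finset.univ.filter (fun j => d j = d i), B.coord j x • B j = 0 := by
    have m1 : ∑ j ∈ Finset.univ.filter (fun j => d j = d i), B.coord j x • B j ∈ gr F L a := by
      rw [← eq_sub_iff_add_eq'] at hsum
      rw [hsum]; exact sub_mem hx (hmem a)
    have m2 := hmem (d i)
    have hd := Submodule.disjoint_def.1 (SuperModule.isCompl_grade (F := F) (V := L)).disjoint
    rcases zmod2_cases a with rfl | rfl <;> rcases zmod2_cases (d i) with h | h
    · exact absurd h hi
    · rw [h] at m2; rw [h]; rw [h] at m1; exact hd _ m1 m2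
    · rw [h] at m2; rw [h]; rw [h] at m1; exact hd _ m2 m1
    · exact absurd h hi
  have := congrArg (B.coord i) h0
  rw [map_sum, Finset.sum_eq_single i] at this
  · simpa using this
  · intro j _ hj
    simp [Finsupp.single_apply, hj]
  · intro h
    exact absurd (by simp) h

lemma backward [FiniteDimensional F L] (p : TensorSqPairing F L T)
    (hT : IsTensorSquare F L T p)
    (hD : DecompHeisenbergAbelian F L 1 0 (finrank F (gr F L 0) - 3) (finrank F (gr F L 1))) :
    finrank F T = (finrank F L - 1) * (finrank F L - 1) + 2 := by
  obtain ⟨xv, yv, zv, A, hxv, -, hz, hAg, ha, hb, hAc, hli, hdisj, hsup, hxx, -, -, -, hxz, hzx, -, -,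
    hzz⟩ := hD
  have hz0 : zv ≠ 0 := hli.ne_zero (Sum.inr (Sum.inr ()))
  have d2 : finrank F (gr F L 0) + finrank F (gr F L 1) = finrank F L :=
    Submodule.finrank_add_eq_of_isCompl (SuperModule.isCompl_grade (F := F) (V := L))
  have d1 := Submodule.finrank_add_eq_of_isCompl (IsCompl.mk hdisj (codisjoint_iff.2 hsup))
  rw [finrank_span_eq_card hli] at d1
  have d3 := finrank_split A hAg
  simp at d1
  have b12 : br F L (xv 0) (xv 1) = zv := by rw [hxx]; simp
  have b21 : br F L (xv 1) (xv 0) = -zv := by rw [hxx]; simp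
  have b11 : br F L (xv 0) (xv 0) = 0 := by rw [hxx]; simp
  have b22 : br F L (xv 1) (xv 1) = 0 := by rw [hxx]; simp
  let B0 := Module.finBasisOfFinrankEq F _ ha
  let B1 := Module.finBasisOfFinrankEq F _ hb
  let fam : (Bool ⊕ (Fin (finrank F (gr F L 0) - 3) ⊕ Fin (finrank F (gr F L 1)))) ⊕ Unit → L :=
    Sum.elim (Sum.elim (fun s => if s then xv 0 else xv 1)
      (Sum.elim (fun i => (B0 i : L)) (fun i => (B1 i : L)))) (fun _ => zv)
  let d : (Bool ⊕ (Fin (finrank F (gr F L 0) - 3) ⊕ Fin (finrank F (gr F L 1)))) → ZMod 2 :=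
    Sum.elim (fun _ => 0) (Sum.elim (fun _ => 0) (fun _ => 1))
  have hmem : ∀ i, fam i ∈ Submodule.span F (Set.range fam) := fun i => Submodule.subset_span ⟨i, rfl⟩
  have hspan : ⊤ ≤ Submodule.span F (Set.range fam) := by
    rw [← hsup]
    refine sup_le (Submodule.span_le.2 ?_) (hAg.trans (sup_le ?_ ?_))
    · rintro _ ⟨i | i | i, rfl⟩
      · fin_cases i
        · exact hmem (Sum.inl (Sum.inl true))
        · exact hmem (Sum.inl (Sum.inl false))
      · exact i.elim0
      · exact hmem (Sum.inr ())
    · intro x hx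
      have := congrArg Subtype.val (B0.sum_repr ⟨x, hx⟩)
      simp only [AddSubmonoidClass.coe_finsetSum, Submodule.coe_smul] at this
      rw [← this]
      exact Submodule.sum_mem _ fun i _ => Submodule.smul_mem _ _ (hmem (Sum.inl (Sum.inr (Sum.inl i))))
    · intro x hx
      have := congrArg Subtype.val (B1.sum_repr ⟨x, hx⟩)
      simp only [AddSubmonoidClass.coe_finsetSum, Submodule.coe_smul] at this
      rw [← this]
      exact Submodule.sum_mem _ fun i _ => Submodule.smul_mem _ _ (hmem (Sum.inl (Sum.inr (Sum.inr i))))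
  have hcard : Fintype.card ((Bool ⊕ (Fin (finrank F (gr F L 0) - 3) ⊕ Fin (finrank F (gr F L 1)))) ⊕ Unit)
      = finrank F L := by
    simp; omega
  let B := basisOfTopLeSpanOfCardEqFinrank fam hspan hcard
  have hB : ∀ i, B i = fam i := fun i => by simp [B]
  have hBg : ∀ i, B i ∈ gr F L (Sum.elim d (fun _ => 0) i) := by
    intro i
    rw [hB]
    rcases i with (s | i | i) | i
    · cases s
      · exact hxv 1
      · exact hxv 0
    · exact (B0 i).2.2
    · exact (B1 i).2.2
    · exact hz
  have hbr : ∀ x y, br F L x y = (B.coord (Sum.inl (Sum.inl true)) x * B.coord (Sum.inl (Sum.inl false)) y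
      - B.coord (Sum.inl (Sum.inl false)) x * B.coord (Sum.inl (Sum.inl true)) y) • zv := by
    let R : L →ₗ[F] L →ₗ[F] L := LinearMap.mk₂ F (fun x y =>
      (B.coord (Sum.inl (Sum.inl true)) x * B.coord (Sum.inl (Sum.inl false)) y
      - B.coord (Sum.inl (Sum.inl false)) x * B.coord (Sum.inl (Sum.inl true)) y) • zv)
      (by intros; simp only [map_add]; module)
      (by intros; simp only [map_smul, smul_eq_mul]; module)
      (by intros; simp only [map_add]; module)
      (by intros; simp only [map_smul, smul_eq_mul]; module)
    have : br F L = R := by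
      refine B.ext fun i => B.ext fun j => ?_
      have hR : R (B i) (B j) = (B.coord (Sum.inl (Sum.inl true)) (B i) * B.coord (Sum.inl (Sum.inl false)) (B j)
      - B.coord (Sum.inl (Sum.inl false)) (B i) * B.coord (Sum.inl (Sum.inl true)) (B j)) • zv := rfl
      rw [hR]
      simp only [Basis.coord_apply, Basis.repr_self]
      rw [hB, hB]
      have hB0 := fun i v => hAc _ (B0 i).2.1 v
      have hB1 := fun i v => hAc _ (B1 i).2.1 v
      rcases i with ((_ | _) | i | i) | i <;> rcases j with ((_ | _) | j | j) | j <;>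
        simp [fam, b11, b12, b21, b22, hxz, hzx, hzz, (hB0 _ _).1, (hB0 _ _).2,
          (hB1 _ _).1, (hB1 _ _).2]
    intro x y
    rw [this]; rfl
  -- upper bound
  have hzA : ∀ u ∈ A, p.pair zv u = 0 ∧ p.pair u zv = 0 := by
    intro u hu
    have r : ∀ a, ∀ u ∈ A, u ∈ gr F L a → p.pair zv u = 0 ∧ p.pair u zv = 0 := by
      intro a u hu hua
      have r1 := p.rel1 0 0 (xv 0) (xv 1) u (hxv 0) (hxv 1)
      have r2 := p.rel2 a 0 0 u (xv 0) (xv 1) hua (hxv 0) (hxv 1)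
      rw [b12, (hAc u hu _).2, (hAc u hu _).2] at r1 r2
      simpa using And.intro r1 r2
    obtain ⟨s, hs, t, ht, rfl⟩ := Submodule.mem_sup.1 (hAg hu)
    have h1 := r 0 s hs.1 hs.2
    have h2 := r 1 t ht.1 ht.2
    simp [h1.1, h1.2, h2.1, h2.2]
  have hz1 : p.pair zv (xv 0) = - p.pair (xv 0) zv := by
    have r1 := p.rel1 0 0 (xv 0) (xv 1) (xv 0) (hxv 0) (hxv 1)
    rw [b12, b21, b11] at r1
    simpa using r1
  have hz2 : p.pair zv (xv 1) = - p.pair (xv 1) zv := by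
    have r1 := p.rel1 0 0 (xv 0) (xv 1) (xv 1) (hxv 0) (hxv 1)
    rw [b12, b22, sgn00] at r1
    simpa using r1
  have hz3 : p.pair zv zv = 0 := by
    have r1 := p.rel1 0 0 (xv 0) (xv 1) zv (hxv 0) (hxv 1)
    rw [b12, hxz, hxz] at r1
    simpa using r1
  let U : Submodule F T := Submodule.span F (Set.range ![p.pair (xv 0) zv, p.pair (xv 1) zv])
  have hU0 : p.pair (xv 0) zv ∈ U := Submodule.subset_span ⟨0, rfl⟩
  have hU1 : p.pair (xv 1) zv ∈ U := Submodule.subset_span ⟨1, rfl⟩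
  have hUall : ∀ x, p.pair zv x ∈ U ∧ p.pair x zv ∈ U := by
    intro x
    have hx : x ∈ Submodule.span F (Set.range fam) := hspan trivial
    induction hx using Submodule.span_induction with
    | mem x hx =>
      obtain ⟨((_ | _) | i | i) | i, rfl⟩ := hx
      · change p.pair zv (xv 1) ∈ U ∧ p.pair (xv 1) zv ∈ U
        rw [hz2]; exact ⟨neg_mem hU1, hU1⟩
      · change p.pair zv (xv 0) ∈ U ∧ p.pair (xv 0) zv ∈ U
        rw [hz1]; exact ⟨neg_mem hU0, hU0⟩
      · have := hzA _ (B0 i).2.1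
        change p.pair zv (B0 i : L) ∈ U ∧ p.pair (B0 i : L) zv ∈ U
        rw [this.1, this.2]; simp
      · have := hzA _ (B1 i).2.1
        change p.pair zv (B1 i : L) ∈ U ∧ p.pair (B1 i : L) zv ∈ U
        rw [this.1, this.2]; simp
      · change p.pair zv zv ∈ U ∧ p.pair zv zv ∈ U
        rw [hz3]; simp
    | zero => simp
    | add x y _ _ hx hy =>
      simp only [map_add, LinearMap.add_apply]
      exact ⟨add_mem hx.1 hy.1, add_mem hx.2 hy.2⟩
    | smul c x _ hx =>
      simp only [map_smul, LinearMap.smul_apply]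
      exact ⟨U.smul_mem _ hx.1, U.smul_mem _ hx.2⟩
  have hUd : finrank F U ≤ 2 := by
    have := finrank_range_le_card (R := F) ![p.pair (xv 0) zv, p.pair (xv 1) zv]
    rw [Fintype.card_fin] at this
    exact this
  have : FiniteDimensional F U := FiniteDimensional.span_of_finite F (Set.finite_range _)
  obtain ⟨hfin, hle⟩ := finrank_le_of p hT zv hz0 U (fun x => (hUall x).1) (fun x => (hUall x).2)
  have hge := lower p hT (fun i => B.coord (Sum.inl i)) (B.coord (Sum.inr ())) (fun s => Sum.inl s)
    (by simp) d (fun s => rfl)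
    (fun i a x hx hi => coord_hom B _ hBg (Sum.inl i) a x hx hi)
    (fun x hx => coord_hom B _ hBg (Sum.inr ()) 1 x hx (by simp))
    zv (fun i => by
      rw [show zv = B (Sum.inr ()) from (hB (Sum.inr ())).symm]; simp)
    (by rw [show zv = B (Sum.inr ()) from (hB (Sum.inr ())).symm]; simp)
    hbr (fun i => B (Sum.inl i)) (fun i j => by simp [Finsupp.single_apply, eq_comm]) (fun i => by simp)
  have hc2 : Fintype.card (Bool ⊕ (Fin (finrank F (gr F L 0) - 3) ⊕ Fin (finrank F (gr F L 1))))
      = finrank F L - 1 := by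
    rw [← hcard, Fintype.card_sum (β := Unit)]; simp
  rw [hc2] at hge
  omega

end backward

theorem stmt_1 (F : Type*) [Field F] (hchar2 : ringChar F ≠ 2) (hchar3 : ringChar F ≠ 3)
    (L : Type*) [AddCommGroup L] [Module F L] [SuperModule F L] [LieSuperAlgebra F L] [FiniteDimensional F L]
    (hnil : IsNilpotentLSA F L) (hnab : ¬ IsAbelianLSA F L)
    (k l : ℕ)
    (hk : finrank F (gr F L 0) = k) (hl : finrank F (gr F L 1) = l)
    (hr : finrank F (derivedSub F L ⊓ gr F L 0 : Submodule F L) = 1)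
    (hs : finrank F (derivedSub F L ⊓ gr F L 1 : Submodule F L) = 0)
    (T : Type*) [AddCommGroup T] [Module F T] [SuperModule F T] [LieSuperAlgebra F T]
    (p : TensorSqPairing F L T) (hT : IsTensorSquare F L T p) :
    finrank F T = (k + l - 1) * (k + l - 1) + 2 ↔
      DecompHeisenbergAbelian F L 1 0 (k - 3) l := by
  have d2 : finrank F (gr F L 0) + finrank F (gr F L 1) = finrank F L :=
    Submodule.finrank_add_eq_of_isCompl (SuperModule.isCompl_grade (F := F) (V := L))
  rw [hk, hl] at d2
  rw [d2]
  constructor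
  · intro hfr
    obtain ⟨zv, φ, hz, hφz, hφ1, hbr, hc, hc'⟩ := setup hnil hr hs
    rw [← hk, ← hl]
    refine forward hchar2 hchar3 hnab p zv φ hz hφz hφ1 hbr hc hc' ?_
    rintro ⟨h1, h2⟩
    have hz0 : zv ≠ 0 := by
      rintro rfl
      simp at hφz
    have := (finrank_le_of p hT zv hz0 ⊥ (by simpa using h1) (by simpa using h2)).2
    rw [finrank_bot] at this
    omega
  · intro hD
    rw [← hk, ← hl] at hD
    exact backward p hT hD
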